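/- Let V, b : ℝ → ℝ be smooth (infinitely differentiable) 1-periodic functions, and suppose the one-dimensional stationary mean field game has a solution (u*, m*, H̄*) with u*, m* smooth and 1-periodic and m* > 0. Then there exists a constant C > 0 such that for every ε ∈ (0,1) there are γ > 0 and N ∈ ℕ with the property: every minimizer (u, m, H̄) of J_γ over 𝒢^N × 𝒢^N × ℝ satisfies Q(u, m, H̄) ≤ Cε. -/

import Mathlib

/-- Membership in the one-dimensional Fourier features space `𝒢^N`. -/
def inG (N : ℕ) (φ : ℝ → ℝ) : Prop :=
  ∃ (c : ℝ) (α β : ℕ → ℝ), ∀ x, φ x =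
    c + (∑ i ∈ Finset.Icc 1 N, α i * Real.sin (2 * Real.pi * i * x))
      + ∑ i ∈ Finset.Icc 1 N, β i * Real.cos (2 * Real.pi * i * x)

/-- The residual functional `Q(u, m, H̄)`. -/
noncomputable def Qfun (V b u m : ℝ → ℝ) (Hbar : ℝ) : ℝ :=
  (∫ x in (0:ℝ)..1,
      (Real.exp (V x + (deriv u x) ^ 2 / 2 + b x * deriv u x - Hbar) - m x) ^ 2)
  + (∫ x in (0:ℝ)..1, u x) ^ 2
  + ((∫ x in (0:ℝ)..1, m x) - 1) ^ 2
  + ∫ x in (0:ℝ)..1,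
      (m x * (deriv (deriv u) x + deriv b x) + deriv m x * (deriv u x + b x)) ^ 2

/-- The penalized objective `J_γ(u, m, H̄)`. -/
noncomputable def Jfun (V b : ℝ → ℝ) (γ : ℝ) (u m : ℝ → ℝ) (Hbar : ℝ) : ℝ :=
  (∫ x in (0:ℝ)..1, (u x) ^ 2) + (∫ x in (0:ℝ)..1, (m x) ^ 2) + Hbar ^ 2
    + γ * Qfun V b u m Hbar

lemma inG.mono {N M : ℕ} (h : N ≤ M) {φ : ℝ → ℝ} (hφ : inG N φ) : inG M φ := by
  obtain ⟨c, α, β, hφ⟩ := hφ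
  have key : ∀ (a : ℕ → ℝ) (g : ℕ → ℝ), ∑ i ∈ Finset.Icc 1 N, a i * g i
      = ∑ i ∈ Finset.Icc 1 M, (if i ≤ N then a i else 0) * g i := by
    intro a g
    rw [← Finset.sum_subset (Finset.Icc_subset_Icc_right h)]
    · refine Finset.sum_congr rfl fun i hi => ?_
      rw [if_pos (Finset.mem_Icc.1 hi).2]
    · intro i hi hi'
      simp only [Finset.mem_Icc] at hi hi'
      rw [if_neg (by omega), zero_mul]
  refine ⟨c, fun i => if i ≤ N then α i else 0, fun i => if i ≤ N then β i else 0, fun x => ?_⟩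
  rw [hφ x, key α, key β]

lemma inG.add {N : ℕ} {φ ψ : ℝ → ℝ} (hφ : inG N φ) (hψ : inG N ψ) :
    inG N (fun x => φ x + ψ x) := by
  obtain ⟨c, α, β, hφ⟩ := hφ
  obtain ⟨c', α', β', hψ⟩ := hψ
  refine ⟨c + c', fun i => α i + α' i, fun i => β i + β' i, fun x => ?_⟩
  simp only [hφ x, hψ x, add_mul, Finset.sum_add_distrib]
  ring

lemma inG.const_mul {N : ℕ} {φ : ℝ → ℝ} (a : ℝ) (hφ : inG N φ) :
    inG N (fun x => a * φ x) := by
  obtain ⟨c, α, β, hφ⟩ := hφ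
  refine ⟨a * c, fun i => a * α i, fun i => a * β i, fun x => ?_⟩
  simp only [hφ x, mul_add, Finset.mul_sum, mul_assoc]

lemma inG_const (N : ℕ) (c : ℝ) : inG N (fun _ => c) :=
  ⟨c, 0, 0, fun x => by simp⟩

lemma inG_cos (n : ℕ) : inG n (fun x => Real.cos (2 * Real.pi * n * x)) := by
  rcases Nat.eq_zero_or_pos n with rfl | hn
  · simpa using inG_const 0 1
  · refine ⟨0, 0, Pi.single n 1, fun x => ?_⟩
    rw [Finset.sum_eq_single n (f := fun i => (Pi.single n 1 : ℕ → ℝ) i * _)]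
    · simp
    · intro i _ hi
      simp [Pi.single_eq_of_ne hi]
    · intro h
      exact absurd (Finset.mem_Icc.2 ⟨hn, le_rfl⟩) h

lemma inG_sin (n : ℕ) : inG n (fun x => Real.sin (2 * Real.pi * n * x)) := by
  rcases Nat.eq_zero_or_pos n with rfl | hn
  · simpa using inG_const 0 0
  · refine ⟨0, Pi.single n 1, 0, fun x => ?_⟩
    rw [Finset.sum_eq_single n (f := fun i => (Pi.single n 1 : ℕ → ℝ) i * _)]
    · simp
    · intro i _ hi
      simp [Pi.single_eq_of_ne hi]
    · intro h
      exact absurd (Finset.mem_Icc.2 ⟨hn, le_rfl⟩) h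

lemma inG.contDiff {N : ℕ} {φ : ℝ → ℝ} (hφ : inG N φ) : ContDiff ℝ (⊤ : ℕ∞) φ := by
  obtain ⟨c, α, β, hφ⟩ := hφ
  rw [funext hφ]
  fun_prop

lemma inG.apply_one {N : ℕ} {φ : ℝ → ℝ} (hφ : inG N φ) : φ 1 = φ 0 := by
  obtain ⟨c, α, β, hφ⟩ := hφ
  rw [hφ, hφ]
  congr 1
  · congr 1
    refine Finset.sum_congr rfl fun i _ => ?_
    have h : 2 * Real.pi * i * 1 = 0 + i * (2 * Real.pi) := by ring
    rw [h, Real.sin_add_nat_mul_two_pi]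
    simp
  · refine Finset.sum_congr rfl fun i _ => ?_
    have h : 2 * Real.pi * i * 1 = 0 + i * (2 * Real.pi) := by ring
    rw [h, Real.cos_add_nat_mul_two_pi]
    simp

/-- Every element of the Fourier features space has, up to its mean, an antiderivative in the
space, with prescribed value at `0`. -/
lemma inG.exists_antideriv {N : ℕ} {p : ℝ → ℝ} (hp : inG N p) (y : ℝ) :
    ∃ (c : ℝ) (q : ℝ → ℝ), inG N q ∧ q 0 = y ∧ ∀ x, HasDerivAt q (p x - c) x := by
  obtain ⟨c, α, β, hp⟩ := hp
  let d : ℝ := y + ∑ i ∈ Finset.Icc 1 N, α i / (2 * Real.pi * i)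
  refine ⟨c, fun x => d
      + (∑ i ∈ Finset.Icc 1 N, (β i / (2 * Real.pi * i)) * Real.sin (2 * Real.pi * i * x))
      + ∑ i ∈ Finset.Icc 1 N, (-(α i / (2 * Real.pi * i))) * Real.cos (2 * Real.pi * i * x),
    ⟨d, _, _, fun x => rfl⟩, ?_, fun x => ?_⟩
  · simp [d]
  · have hlin : ∀ i : ℕ, HasDerivAt (fun x : ℝ => 2 * Real.pi * i * x) (2 * Real.pi * i) x :=
      fun i => by simpa using (hasDerivAt_id x).const_mul (2 * Real.pi * i)
    have h1 := HasDerivAt.fun_sum (u := Finset.Icc 1 N) fun i _ =>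
      ((hlin i).sin).const_mul (β i / (2 * Real.pi * i))
    have h2 := HasDerivAt.fun_sum (u := Finset.Icc 1 N) fun i _ =>
      ((hlin i).cos).const_mul (-(α i / (2 * Real.pi * i)))
    refine ((h1.const_add d).add h2).congr_deriv ?_
    rw [hp x]
    have e1 : ∑ i ∈ Finset.Icc 1 N, β i / (2 * Real.pi * i) *
        (Real.cos (2 * Real.pi * i * x) * (2 * Real.pi * i))
        = ∑ i ∈ Finset.Icc 1 N, β i * Real.cos (2 * Real.pi * i * x) := by
      refine Finset.sum_congr rfl fun i hi => ?_
      have : (i : ℝ) ≠ 0 := by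
        have := (Finset.mem_Icc.1 hi).1
        positivity
      field_simp
    have e2 : ∑ i ∈ Finset.Icc 1 N, -(α i / (2 * Real.pi * i)) *
        (-Real.sin (2 * Real.pi * i * x) * (2 * Real.pi * i))
        = ∑ i ∈ Finset.Icc 1 N, α i * Real.sin (2 * Real.pi * i * x) := by
      refine Finset.sum_congr rfl fun i hi => ?_
      have : (i : ℝ) ≠ 0 := by
        have := (Finset.mem_Icc.1 hi).1
        positivity
      field_simp
    rw [e1, e2]
    ring

/-- The real and imaginary parts of a complex trigonometric polynomial lie in some Fourier
features space. -/
lemma exists_inG_re_im_of_mem_span {P : C(AddCircle (1 : ℝ), ℂ)}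
    (hP : P ∈ Submodule.span ℂ (Set.range (fourier (T := (1 : ℝ))))) :
    ∃ N, inG N (fun x : ℝ => (P x).re) ∧ inG N (fun x : ℝ => (P x).im) := by
  induction hP using Submodule.span_induction with
  | mem P h =>
    obtain ⟨n, rfl⟩ := h
    have e : ∀ x : ℝ, fourier (T := 1) n (x : AddCircle (1 : ℝ))
        = Complex.exp ((2 * Real.pi * n * x : ℝ) * Complex.I) := by
      intro x
      rw [fourier_coe_apply]
      congr 1
      push_cast
      ring
    refine ⟨n.natAbs, ?_, ?_⟩
    · simp only [e, Complex.exp_ofReal_mul_I_re]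
      rcases Int.natAbs_eq n with h | h
      · have h' : (n : ℝ) = (n.natAbs : ℝ) := by rw [← Int.cast_natCast, ← h]
        rw [h']
        exact inG_cos _
      · have h' : (n : ℝ) = -(n.natAbs : ℝ) := by
          rw [← Int.cast_natCast, ← Int.cast_neg, ← h]
        rw [h']
        simpa using inG_cos n.natAbs
    · simp only [e, Complex.exp_ofReal_mul_I_im]
      rcases Int.natAbs_eq n with h | h
      · have h' : (n : ℝ) = (n.natAbs : ℝ) := by rw [← Int.cast_natCast, ← h]
        rw [h']
        exact inG_sin _
      · have h' : (n : ℝ) = -(n.natAbs : ℝ) := by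
          rw [← Int.cast_natCast, ← Int.cast_neg, ← h]
        rw [h']
        simpa using (inG_sin n.natAbs).const_mul (-1)
  | zero => exact ⟨0, by simpa using inG_const 0 0, by simpa using inG_const 0 0⟩
  | add P R _ _ hP hR =>
    obtain ⟨N, h1, h2⟩ := hP
    obtain ⟨M, h3, h4⟩ := hR
    exact ⟨max N M, (h1.mono (le_max_left _ _)).add (h3.mono (le_max_right _ _)),
      (h2.mono (le_max_left _ _)).add (h4.mono (le_max_right _ _))⟩
  | smul a P _ hP =>
    obtain ⟨N, h1, h2⟩ := hP
    refine ⟨N, ?_, ?_⟩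
    · simpa [Complex.mul_re, sub_eq_add_neg] using
        (h1.const_mul a.re).add (h2.const_mul (-a.im))
    · simpa [Complex.mul_im] using (h2.const_mul a.re).add (h1.const_mul a.im)

/-- Uniform density of the Fourier features spaces among continuous `1`-periodic functions. -/
lemma exists_inG_approx {g : ℝ → ℝ} (hg : Continuous g) (hgp : Function.Periodic g 1)
    {δ : ℝ} (hδ : 0 < δ) : ∃ (N : ℕ) (p : ℝ → ℝ), inG N p ∧ ∀ x, |p x - g x| ≤ δ := by
  let G : C(AddCircle (1 : ℝ), ℂ) :=
    ⟨fun z => ((hgp.lift z : ℝ) : ℂ), Complex.continuous_ofReal.comp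
      (continuous_coinduced_dom.2 hg)⟩
  have hG : G ∈ (Submodule.span ℂ (Set.range (fourier (T := (1 : ℝ))))).topologicalClosure := by
    have : Fact ((0 : ℝ) < 1) := ⟨one_pos⟩
    rw [span_fourier_closure_eq_top]
    trivial
  obtain ⟨P, hP, hd⟩ := Metric.mem_closure_iff.1 hG δ hδ
  obtain ⟨N, hN, -⟩ := exists_inG_re_im_of_mem_span hP
  refine ⟨N, _, hN, fun x => ?_⟩
  have h1 : ‖P (x : AddCircle (1 : ℝ)) - G x‖ ≤ δ := by
    rw [← dist_eq_norm, dist_comm]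
    exact (ContinuousMap.dist_apply_le_dist _).trans hd.le
  have h2 := (Complex.abs_re_le_norm _).trans h1
  simpa [G] using h2

/-- An approximation of the derivative integrates to an approximation of the function. -/
lemma inG.exists_approx_of_deriv {N : ℕ} {p f : ℝ → ℝ} (hp : inG N p)
    (hf : Differentiable ℝ f) (hf1 : f 1 = f 0) {δ : ℝ}
    (hδ : ∀ x ∈ Set.Icc (0 : ℝ) 1, |p x - deriv f x| ≤ δ) :
    ∃ (c : ℝ) (q : ℝ → ℝ), inG N q ∧ deriv q = (fun x => p x - c) ∧
      ∀ x ∈ Set.Icc (0 : ℝ) 1, |q x - f x| ≤ 2 * δ ∧ |deriv q x - deriv f x| ≤ 2 * δ := by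
  obtain ⟨c, q, hq, hq0, hd⟩ := hp.exists_antideriv (f 0)
  have hdq : deriv q = fun x => p x - c := funext fun x => (hd x).deriv
  have hh : ∀ x, HasDerivAt (fun x => q x - f x) (p x - c - deriv f x) x :=
    fun x => (hd x).sub (hf x).hasDerivAt
  have hc : |c| ≤ δ := by
    obtain ⟨ξ, hξ, h0⟩ := exists_hasDerivAt_eq_zero (f := fun x => q x - f x) zero_lt_one
      (fun x _ => (hh x).continuousAt.continuousWithinAt)
      (by simp only [hq.apply_one, hf1]) (fun x _ => hh x)
    have := hδ ξ (Set.Ioo_subset_Icc_self hξ)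
    rwa [show p ξ - deriv f ξ = c by linarith] at this
  have hder : ∀ x ∈ Set.Icc (0 : ℝ) 1, |p x - c - deriv f x| ≤ 2 * δ := by
    intro x hx
    have := abs_le.1 (hδ x hx)
    have := abs_le.1 hc
    exact abs_le.2 ⟨by linarith, by linarith⟩
  refine ⟨c, q, hq, hdq, fun x hx => ⟨?_, by simpa only [hdq] using hder x hx⟩⟩
  have h := (convex_Icc (0 : ℝ) 1).norm_image_sub_le_of_norm_hasDerivWithin_le
    (fun y _ => (hh y).hasDerivWithinAt) hder (Set.left_mem_Icc.2 zero_le_one) hx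
  have h2δ : 0 ≤ 2 * δ := (abs_nonneg _).trans (hder x hx)
  simp only [hq0, sub_self, sub_zero, Real.norm_eq_abs, abs_of_nonneg hx.1] at h
  exact h.trans (mul_le_of_le_one_right h2δ hx.2)

lemma exists_inG_approx_one {f : ℝ → ℝ} (hf : ContDiff ℝ (⊤ : ℕ∞) f)
    (hfp : Function.Periodic f 1) {δ : ℝ} (hδ : 0 < δ) :
    ∃ (N : ℕ) (q : ℝ → ℝ), inG N q ∧ ∀ x ∈ Set.Icc (0 : ℝ) 1,
      |q x - f x| ≤ δ ∧ |deriv q x - deriv f x| ≤ δ := by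
  obtain ⟨N, p, hp, h⟩ := exists_inG_approx (hf.continuous_deriv (by simp))
    (fun x => by rw [← deriv_comp_add_const, funext hfp]) (half_pos hδ)
  obtain ⟨c, q, hq, -, h'⟩ := hp.exists_approx_of_deriv (hf.differentiable (by simp))
    (by simpa using hfp 0) fun x _ => h x
  refine ⟨N, q, hq, fun x hx => ?_⟩
  simpa only [mul_div_cancel₀ δ (two_ne_zero' ℝ)] using h' x hx

lemma exists_inG_approx_two {f : ℝ → ℝ} (hf : ContDiff ℝ (⊤ : ℕ∞) f)
    (hfp : Function.Periodic f 1) {δ : ℝ} (hδ : 0 < δ) :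
    ∃ (N : ℕ) (q : ℝ → ℝ), inG N q ∧ ∀ x ∈ Set.Icc (0 : ℝ) 1,
      |q x - f x| ≤ δ ∧ |deriv q x - deriv f x| ≤ δ ∧
        |deriv (deriv q) x - deriv (deriv f) x| ≤ δ := by
  obtain ⟨N, p, hp, h⟩ := exists_inG_approx_one (f := deriv f)
    (by simpa using hf.iterate_deriv 1)
    (fun x => by rw [← deriv_comp_add_const, funext hfp]) (half_pos hδ)
  obtain ⟨c, q, hq, hqd, h'⟩ := hp.exists_approx_of_deriv (hf.differentiable (by simp))
    (by simpa using hfp 0) fun x hx => (h x hx).1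
  refine ⟨N, q, hq, fun x hx => ?_⟩
  have h1 := h' x hx
  rw [mul_div_cancel₀ δ (two_ne_zero' ℝ)] at h1
  refine ⟨h1.1, h1.2, ?_⟩
  rw [hqd, deriv_sub_const]
  linarith [(h x hx).2]

/-- Integrals of a continuous superposition converge along a uniformly convergent sequence of
continuous functions. -/
lemma tendsto_integral_superposition {E : Type*} [NormedAddCommGroup E] [ProperSpace E]
    {F : ℝ × E → ℝ} (hF : Continuous F) {w : ℕ → ℝ → E} {w₀ : ℝ → E}
    (hw : ∀ n, Continuous (w n)) (hw₀ : Continuous w₀) {δ : ℕ → ℝ}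
    (hδ : Filter.Tendsto δ Filter.atTop (nhds 0))
    (h : ∀ n, ∀ x ∈ Set.Icc (0 : ℝ) 1, ‖w n x - w₀ x‖ ≤ δ n) :
    Filter.Tendsto (fun n => ∫ x in (0 : ℝ)..1, F (x, w n x)) Filter.atTop
      (nhds (∫ x in (0 : ℝ)..1, F (x, w₀ x))) := by
  obtain ⟨R, hR⟩ := (isCompact_Icc (a := (0 : ℝ)) (b := 1)).exists_bound_of_continuousOn
    hw₀.continuousOn
  obtain ⟨D, hD⟩ := hδ.bddAbove_range
  obtain ⟨M, hM⟩ := ((isCompact_Icc (a := (0 : ℝ)) (b := 1)).prod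
    (isCompact_closedBall (0 : E) (R + D))).exists_bound_of_continuousOn hF.continuousOn
  have hI : ∀ x ∈ Set.uIoc (0 : ℝ) 1, x ∈ Set.Icc (0 : ℝ) 1 := by
    intro x hx
    rw [Set.uIoc_of_le zero_le_one] at hx
    exact Set.Ioc_subset_Icc_self hx
  refine intervalIntegral.tendsto_integral_filter_of_dominated_convergence (fun _ => M)
    (Filter.Eventually.of_forall fun n =>
      (hF.comp (continuous_id.prodMk (hw n))).aestronglyMeasurable)
    (Filter.Eventually.of_forall fun n => Filter.Eventually.of_forall fun x hx => ?_)
    intervalIntegrable_const (Filter.Eventually.of_forall fun x hx => ?_)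
  · refine hM _ ⟨hI x hx, mem_closedBall_zero_iff.2 ?_⟩
    calc ‖w n x‖ = ‖w₀ x + (w n x - w₀ x)‖ := by rw [add_sub_cancel]
      _ ≤ ‖w₀ x‖ + ‖w n x - w₀ x‖ := norm_add_le _ _
      _ ≤ R + D := add_le_add (hR x (hI x hx)) ((h n x (hI x hx)).trans (hD ⟨n, rfl⟩))
  · refine (hF.tendsto _).comp (Filter.Tendsto.prodMk_nhds tendsto_const_nhds ?_)
    exact tendsto_iff_norm_sub_tendsto_zero.2
      (squeeze_zero (fun _ => norm_nonneg _) (fun n => h n x (hI x hx)) hδ)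

/-- The residual depends continuously on `u` in `C²` and `m` in `C¹`. -/
lemma tendsto_Qfun {V b u₀ m₀ : ℝ → ℝ} (H : ℝ) (hV : Continuous V)
    (hb : ContDiff ℝ (⊤ : ℕ∞) b) (hu₀ : ContDiff ℝ (⊤ : ℕ∞) u₀) (hm₀ : ContDiff ℝ (⊤ : ℕ∞) m₀)
    {u m : ℕ → ℝ → ℝ} (hu : ∀ n, ContDiff ℝ (⊤ : ℕ∞) (u n))
    (hm : ∀ n, ContDiff ℝ (⊤ : ℕ∞) (m n)) {δ : ℕ → ℝ}
    (hδ : Filter.Tendsto δ Filter.atTop (nhds 0))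
    (hun : ∀ n, ∀ x ∈ Set.Icc (0 : ℝ) 1, |u n x - u₀ x| ≤ δ n ∧
      |deriv (u n) x - deriv u₀ x| ≤ δ n ∧ |deriv (deriv (u n)) x - deriv (deriv u₀) x| ≤ δ n)
    (hmn : ∀ n, ∀ x ∈ Set.Icc (0 : ℝ) 1, |m n x - m₀ x| ≤ δ n ∧
      |deriv (m n) x - deriv m₀ x| ≤ δ n) :
    Filter.Tendsto (fun n => Qfun V b (u n) (m n) H) Filter.atTop
      (nhds (Qfun V b u₀ m₀ H)) := by
  have hd : ∀ {f : ℝ → ℝ}, ContDiff ℝ (⊤ : ℕ∞) f → ContDiff ℝ (⊤ : ℕ∞) (deriv f) :=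
    fun hf => by simpa using hf.iterate_deriv 1
  let jet : (ℝ → ℝ) → (ℝ → ℝ) → ℝ → ℝ × ℝ × ℝ × ℝ × ℝ := fun u m x =>
    (u x, deriv u x, deriv (deriv u) x, m x, deriv m x)
  have hjet : ∀ {u m : ℝ → ℝ}, ContDiff ℝ (⊤ : ℕ∞) u → ContDiff ℝ (⊤ : ℕ∞) m →
      Continuous (jet u m) := fun hu hm =>
    hu.continuous.prodMk ((hd hu).continuous.prodMk ((hd (hd hu)).continuous.prodMk
      (hm.continuous.prodMk (hd hm).continuous)))
  have hclose : ∀ n, ∀ x ∈ Set.Icc (0 : ℝ) 1, ‖jet (u n) (m n) x - jet u₀ m₀ x‖ ≤ δ n := by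
    intro n x hx
    obtain ⟨h1, h2, h3⟩ := hun n x hx
    obtain ⟨h4, h5⟩ := hmn n x hx
    simp only [jet, Prod.mk_sub_mk, norm_prod_le_iff, Real.norm_eq_abs]
    exact ⟨h1, h2, h3, h4, h5⟩
  have key : ∀ {F : ℝ × ℝ × ℝ × ℝ × ℝ × ℝ → ℝ}, Continuous F → _ := fun {F} hF =>
    tendsto_integral_superposition hF (fun n => hjet (hu n) (hm n)) (hjet hu₀ hm₀) hδ hclose
  have hbc := hb.continuous
  have hbd := (hd hb).continuous
  have k1 := key (F := fun z => (Real.exp (V z.1 + z.2.2.1 ^ 2 / 2 + b z.1 * z.2.2.1 - H)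
    - z.2.2.2.2.1) ^ 2) (by fun_prop)
  have k2 := key (F := fun z => z.2.1) (by fun_prop)
  have k3 := key (F := fun z => z.2.2.2.2.1) (by fun_prop)
  have k4 := key (F := fun z => (z.2.2.2.2.1 * (z.2.2.2.1 + deriv b z.1)
    + z.2.2.2.2.2 * (z.2.2.1 + b z.1)) ^ 2) (by fun_prop)
  exact ((k1.add (k2.pow 2)).add ((k3.sub_const 1).pow 2)).add k4

/-- A smooth solution of the mean field game has zero residual. -/
lemma Qfun_eq_zero {V b u m : ℝ → ℝ} {H : ℝ} (hb : ContDiff ℝ (⊤ : ℕ∞) b)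
    (hu : ContDiff ℝ (⊤ : ℕ∞) u) (hm : ContDiff ℝ (⊤ : ℕ∞) m) (hmpos : ∀ x, 0 < m x)
    (hHJB : ∀ x, (deriv u x) ^ 2 / 2 + V x + b x * deriv u x = Real.log (m x) + H)
    (hFP : ∀ x, deriv (fun y => m y * (deriv u y + b y)) x = 0)
    (hm1 : (∫ x in (0:ℝ)..1, m x) = 1) (hu0 : (∫ x in (0:ℝ)..1, u x) = 0) :
    Qfun V b u m H = 0 := by
  have h1 : ∀ x, Real.exp (V x + (deriv u x) ^ 2 / 2 + b x * deriv u x - H) - m x = 0 := by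
    intro x
    rw [show V x + (deriv u x) ^ 2 / 2 + b x * deriv u x - H = Real.log (m x) by
      linarith [hHJB x], Real.exp_log (hmpos x), sub_self]
  have hdu : Differentiable ℝ (deriv u) :=
    ContDiff.differentiable (n := (⊤ : ℕ∞)) (by simpa using hu.iterate_deriv 1) (by simp)
  have h2 : ∀ x, m x * (deriv (deriv u) x + deriv b x) + deriv m x * (deriv u x + b x) = 0 := by
    intro x
    have hmx := (hm.differentiable (by simp) x).hasDerivAt
    have hbx := (hb.differentiable (by simp) x).hasDerivAt
    have := (hmx.mul ((hdu x).hasDerivAt.add hbx)).deriv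
    have h0 := hFP x
    change deriv (m * (deriv u + b)) x = 0 at h0
    rw [h0] at this
    simp only [Pi.add_apply] at this
    linarith
  simp [Qfun, h1, h2, hm1, hu0]

/-- Corollary 2.5: for large `γ` and `N`, every minimizer of `J_γ` over
`𝒢^N × 𝒢^N × ℝ` has small residual `Q`. -/
theorem stmt_7 (V b : ℝ → ℝ)
    (hV : ContDiff ℝ (⊤ : ℕ∞) V) (hVp : ∀ x, V (x + 1) = V x)
    (hb : ContDiff ℝ (⊤ : ℕ∞) b) (hbp : ∀ x, b (x + 1) = b x)
    (ustar mstar : ℝ → ℝ) (Hstar : ℝ)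
    (hus : ContDiff ℝ (⊤ : ℕ∞) ustar) (husp : ∀ x, ustar (x + 1) = ustar x)
    (hms : ContDiff ℝ (⊤ : ℕ∞) mstar) (hmsp : ∀ x, mstar (x + 1) = mstar x)
    (hmpos : ∀ x, 0 < mstar x)
    (hHJB : ∀ x, (deriv ustar x) ^ 2 / 2 + V x + b x * deriv ustar x
      = Real.log (mstar x) + Hstar)
    (hFP : ∀ x, deriv (fun y => mstar y * (deriv ustar y + b y)) x = 0)
    (hm1 : (∫ x in (0:ℝ)..1, mstar x) = 1)
    (hu0 : (∫ x in (0:ℝ)..1, ustar x) = 0) :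
    ∃ C > 0, ∀ ε ∈ Set.Ioo (0:ℝ) 1, ∃ γ : ℝ, 0 < γ ∧ ∃ N : ℕ,
      ∀ (u m : ℝ → ℝ) (Hbar : ℝ), inG N u → inG N m →
        (∀ (u' m' : ℝ → ℝ) (H' : ℝ), inG N u' → inG N m' →
          Jfun V b γ u m Hbar ≤ Jfun V b γ u' m' H') →
        Qfun V b u m Hbar ≤ C * ε := by
  refine ⟨1, one_pos, fun ε hε => ?_⟩
  have hpos : ∀ n : ℕ, (0 : ℝ) < 1 / ((n : ℝ) + 1) := fun n => by positivity
  choose N₁ u hu hun using fun n => exists_inG_approx_two hus husp (hpos n)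
  choose N₂ m hm hmn using fun n => exists_inG_approx_one hms hmsp (hpos n)
  have hlim := tendsto_Qfun Hstar hV.continuous hb hus hms (fun n => (hu n).contDiff)
    (fun n => (hm n).contDiff) tendsto_one_div_add_atTop_nhds_zero_nat hun hmn
  rw [Qfun_eq_zero hb hus hms hmpos hHJB hFP hm1 hu0] at hlim
  obtain ⟨n, hn⟩ := (hlim.eventually_lt_const (half_pos hε.1)).exists
  obtain ⟨K, hK⟩ : ∃ K, K = (∫ x in (0:ℝ)..1, (u n x) ^ 2) + (∫ x in (0:ℝ)..1, (m n x) ^ 2)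
    + Hstar ^ 2 := ⟨_, rfl⟩
  have hsq : ∀ f : ℝ → ℝ, 0 ≤ ∫ x in (0:ℝ)..1, (f x) ^ 2 := fun f =>
    intervalIntegral.integral_nonneg zero_le_one fun x _ => sq_nonneg _
  have hK0 : 0 ≤ K := by
    have := hsq (u n)
    have := hsq (m n)
    rw [hK]
    positivity
  have hγ : 0 < 2 * (K + 1) / ε := div_pos (by linarith) hε.1
  refine ⟨2 * (K + 1) / ε, hγ, max (N₁ n) (N₂ n), fun v μ H _ _ hmin => ?_⟩
  have h := hmin (u n) (m n) Hstar ((hu n).mono (le_max_left _ _))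
    ((hm n).mono (le_max_right _ _))
  simp only [Jfun] at h
  rw [← hK] at h
  have hγε : 2 * (K + 1) / ε * (ε / 2) = K + 1 := by
    have := hε.1.ne'
    field_simp
  refine le_of_mul_le_mul_left ?_ hγ
  have h1 := mul_le_mul_of_nonneg_left hn.le hγ.le
  linarith [hsq v, hsq μ, sq_nonneg H]
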